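/- arXiv:1412.4459 — 3 statements merged into one kernel-verified Lean document; each statement's English description precedes it below -/
import Mathlib

section
/- Let (E, ℰ) be a measurable space, κ > 0, ℓ : E → ℝ measurable with κ ≤ ℓ(u) ≤ 1/κ for all u ∈ E, and K a Markov kernel on E. Let Φ be the map on probability measures defined by (Φμ)(A) = (∫ ℓ(y) K(y, A) μ(dy)) / (∫ ℓ dμ). Then for any two random probability measures μ, ν on E (defined on a common probability space), d(Φμ, Φν) ≤ (2/κ²) · d(μ, ν). -/
open MeasureTheory ProbabilityTheory

/-- The distance `d` between two random probability measures. -/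
noncomputable def dRPM {Ω E : Type*} [MeasurableSpace Ω] [MeasurableSpace E]
    (P : Measure Ω) (μ ν : Ω → Measure E) : ℝ :=
  sSup { r : ℝ | ∃ f : E → ℝ, Measurable f ∧ (∀ v, |f v| ≤ 1) ∧
    r = Real.sqrt (∫ ω, |(∫ x, f x ∂(μ ω)) - ∫ x, f x ∂(ν ω)| ^ 2 ∂P) }

/-- A random probability measure. -/
def IsRandomProbabilityMeasure {Ω E : Type*} [MeasurableSpace Ω] [MeasurableSpace E]
    (μ : Ω → Measure E) : Prop :=
  (∀ ω, IsProbabilityMeasure (μ ω)) ∧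
    ∀ f : E → ℝ, Measurable f → (∀ v, |f v| ≤ 1) →
      Measurable fun ω => ∫ x, f x ∂(μ ω)

/-- The map on measures `(Φ μ)(A) = (∫ ℓ(y) K(y,A) μ(dy)) / μ(ℓ)`. -/
noncomputable def PhiMap {E : Type*} [MeasurableSpace E]
    (ℓ : E → ℝ) (K : Kernel E E) (μ : Measure E) : Measure E :=
  (ENNReal.ofReal (∫ y, ℓ y ∂μ))⁻¹ •
    (μ.withDensity fun y => ENNReal.ofReal (ℓ y)).bind fun y => K y

theorem integrable_of_abs_le {E : Type*} [MeasurableSpace E] (m : Measure E) [IsFiniteMeasure m]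
    {f : E → ℝ} (hf : Measurable f) {C : ℝ} (hb : ∀ v, |f v| ≤ C) : Integrable f m :=
  Integrable.of_bound hf.aestronglyMeasurable C (ae_of_all _ fun v => by simpa using hb v)

theorem abs_integral_le_of_abs_le {E : Type*} [MeasurableSpace E] (m : Measure E)
    [IsProbabilityMeasure m] {f : E → ℝ} {C : ℝ} (hb : ∀ v, |f v| ≤ C) :
    |∫ x, f x ∂m| ≤ C := by
  simpa using norm_integral_le_of_norm_le_const (μ := m) (f := f) (C := C) (ae_of_all _ hb)

theorem integral_phiMap {E : Type*} [MeasurableSpace E] {ℓ : E → ℝ} (hℓ : Measurable ℓ) {C : ℝ}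
    (hℓ0 : ∀ u, 0 ≤ ℓ u) (hℓC : ∀ u, ℓ u ≤ C) (K : Kernel E E) [IsMarkovKernel K]
    (m : Measure E) [IsFiniteMeasure m] {f : E → ℝ} (hf : Measurable f) (hf1 : ∀ v, |f v| ≤ 1) :
    ∫ x, f x ∂(PhiMap ℓ K m) = (∫ y, ℓ y ∂m)⁻¹ * ∫ y, ℓ y * ∫ z, f z ∂(K y) ∂m := by
  have hint : Integrable ℓ m :=
    integrable_of_abs_le m hℓ fun v => (abs_of_nonneg (hℓ0 v)).trans_le (hℓC v)
  have := isFiniteMeasure_withDensity_ofReal hint.2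
  have hbind : ∫ x, f x ∂((m.withDensity fun y => ENNReal.ofReal (ℓ y)).bind fun y => K y) =
      ∫ y, ∫ z, f z ∂(K y) ∂(m.withDensity fun y => ENNReal.ofReal (ℓ y)) := by
    rw [Measure.comp_eq_comp_const_apply, Kernel.integral_comp (integrable_of_abs_le _ hf hf1),
      Kernel.const_apply]
  rw [PhiMap, integral_smul_measure, hbind,
    integral_withDensity_eq_integral_toReal_smul hℓ.ennreal_ofReal (by simp)]
  simp only [ENNReal.toReal_inv, ENNReal.toReal_ofReal (integral_nonneg hℓ0),
    ENNReal.toReal_ofReal (hℓ0 _), smul_eq_mul]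

section RandomProbabilityMeasure

variable {Ω E : Type*} [MeasurableSpace Ω] [MeasurableSpace E] {μ ν : Ω → Measure E}

theorem abs_integral_sub_integral_le_two (hμ : IsRandomProbabilityMeasure μ)
    (hν : IsRandomProbabilityMeasure ν) {f : E → ℝ} (hf1 : ∀ v, |f v| ≤ 1) (ω : Ω) :
    |(∫ x, f x ∂(μ ω)) - ∫ x, f x ∂(ν ω)| ≤ 2 := by
  have := hμ.1 ω
  have := hν.1 ω
  have h₁ := abs_integral_le_of_abs_le (μ ω) hf1
  have h₂ := abs_integral_le_of_abs_le (ν ω) hf1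
  rw [abs_le] at *
  constructor <;> linarith

theorem integrable_sq_integral_sub_integral (P : Measure Ω) [IsProbabilityMeasure P]
    (hμ : IsRandomProbabilityMeasure μ) (hν : IsRandomProbabilityMeasure ν) {f : E → ℝ}
    (hf : Measurable f) (hf1 : ∀ v, |f v| ≤ 1) :
    Integrable (fun ω => |(∫ x, f x ∂(μ ω)) - ∫ x, f x ∂(ν ω)| ^ 2) P := by
  have hm : Measurable fun ω => |(∫ x, f x ∂(μ ω)) - ∫ x, f x ∂(ν ω)| :=
    ((hμ.2 f hf hf1).sub (hν.2 f hf hf1)).abs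
  refine integrable_of_abs_le P (hm.pow_const 2) (C := 2 ^ 2) fun ω => ?_
  rw [abs_of_nonneg (by positivity)]
  gcongr
  exact abs_integral_sub_integral_le_two hμ hν hf1 ω

theorem dRPM_nonneg {P : Measure Ω} : 0 ≤ dRPM P μ ν := by
  refine Real.sSup_nonneg ?_
  rintro _ ⟨f, -, -, rfl⟩
  exact Real.sqrt_nonneg _

theorem integral_sq_le_dRPM_sq (P : Measure Ω) [IsProbabilityMeasure P]
    (hμ : IsRandomProbabilityMeasure μ) (hν : IsRandomProbabilityMeasure ν) {f : E → ℝ}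
    (hf : Measurable f) (hf1 : ∀ v, |f v| ≤ 1) :
    ∫ ω, |(∫ x, f x ∂(μ ω)) - ∫ x, f x ∂(ν ω)| ^ 2 ∂P ≤ dRPM P μ ν ^ 2 := by
  refine (Real.sqrt_le_left dRPM_nonneg).1 (le_csSup ⟨2, ?_⟩ ⟨f, hf, hf1, rfl⟩)
  rintro _ ⟨g, hg, hg1, rfl⟩
  refine Real.sqrt_le_iff.2 ⟨by norm_num, ?_⟩
  calc ∫ ω, |(∫ x, g x ∂(μ ω)) - ∫ x, g x ∂(ν ω)| ^ 2 ∂P ≤ ∫ _, 2 ^ 2 ∂P := by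
        refine integral_mono (integrable_sq_integral_sub_integral P hμ hν hg hg1)
          (integrable_const _) fun ω => ?_
        have := abs_integral_sub_integral_le_two hμ hν hg1 ω
        dsimp only
        gcongr
    _ = 2 ^ 2 := by simp

end RandomProbabilityMeasure

/-- Two self-normalised averages `p / a` and `q / b` with `|q| ≤ b` are close when their numerators
and denominators are. -/
theorem sq_inv_mul_sub_inv_mul_le {κ a b p q : ℝ} (hκ : 0 < κ) (ha : κ ≤ a) (hb : κ ≤ b)
    (hq : |q| ≤ b) :
    |a⁻¹ * p - b⁻¹ * q| ^ 2 ≤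
      2 / κ ^ 4 * (|κ * p - κ * q| ^ 2 + |κ * a - κ * b| ^ 2) := by
  have ha0 : 0 < a := hκ.trans_le ha
  have hb0 : 0 < b := hκ.trans_le hb
  set t := b⁻¹ * q with ht
  have hqt : q = b * t := by rw [ht]; field_simp
  have ht1 : t ^ 2 ≤ 1 := by
    rw [sq_le_one_iff_abs_le_one, ht, abs_mul, abs_inv, abs_of_pos hb0]
    exact (inv_mul_le_one₀ hb0).2 hq
  have e : a⁻¹ * p - t = a⁻¹ * ((p - q) - t * (a - b)) := by
    rw [hqt]; field_simp; ring
  have h₁ : ((p - q) - t * (a - b)) ^ 2 ≤ 2 * ((p - q) ^ 2 + (a - b) ^ 2) := by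
    nlinarith [sq_nonneg ((p - q) + t * (a - b)),
      mul_le_mul_of_nonneg_right ht1 (sq_nonneg (a - b))]
  have h₂ : a⁻¹ ^ 2 ≤ κ⁻¹ ^ 2 := by gcongr
  simp only [sq_abs]
  calc (a⁻¹ * p - t) ^ 2 = a⁻¹ ^ 2 * ((p - q) - t * (a - b)) ^ 2 := by rw [e, mul_pow]
    _ ≤ κ⁻¹ ^ 2 * (2 * ((p - q) ^ 2 + (a - b) ^ 2)) := by gcongr
    _ = _ := by field_simp

theorem phi_lipschitz
    {Ω E : Type*} [MeasurableSpace Ω] [MeasurableSpace E]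
    (P : Measure Ω) [IsProbabilityMeasure P]
    (κ : ℝ) (hκ : 0 < κ)
    (ℓ : E → ℝ) (hℓmeas : Measurable ℓ)
    (hℓ : ∀ u, κ ≤ ℓ u ∧ ℓ u ≤ 1 / κ)
    (K : Kernel E E) [IsMarkovKernel K]
    (μ ν : Ω → Measure E)
    (hμ : IsRandomProbabilityMeasure μ) (hν : IsRandomProbabilityMeasure ν) :
    dRPM P (fun ω => PhiMap ℓ K (μ ω)) (fun ω => PhiMap ℓ K (ν ω)) ≤
      2 / κ ^ 2 * dRPM P μ ν := by
  refine csSup_le ⟨_, fun _ => 0, measurable_const, by simp, rfl⟩ ?_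
  rintro _ ⟨f, hf, hf1, rfl⟩
  have hd : 0 ≤ dRPM P μ ν := dRPM_nonneg
  have hℓ0 : ∀ u, 0 ≤ ℓ u := fun u => hκ.le.trans (hℓ u).1
  have hκℓ : ∀ u, |κ * ℓ u| ≤ 1 := fun u => by
    rw [abs_of_nonneg (mul_nonneg hκ.le (hℓ0 u)), mul_comm]
    exact (le_div_iff₀ hκ).1 (hℓ u).2
  have hKf : ∀ u, |∫ z, f z ∂(K u)| ≤ 1 := fun u => abs_integral_le_of_abs_le (K u) hf1
  have hKfm : Measurable fun u => ∫ z, f z ∂(K u) := hf.stronglyMeasurable.integral_kernel.measurable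
  have hgm : Measurable fun u => κ * (ℓ u * ∫ z, f z ∂(K u)) := (hℓmeas.mul hKfm).const_mul κ
  have hg1 : ∀ u, |κ * (ℓ u * ∫ z, f z ∂(K u))| ≤ 1 := fun u => by
    rw [← mul_assoc, abs_mul]
    exact mul_le_one₀ (hκℓ u) (abs_nonneg _) (hKf u)
  have hhm : Measurable fun u => κ * ℓ u := hℓmeas.const_mul κ
  have hint : ∀ (m : Measure E) [IsProbabilityMeasure m], Integrable ℓ m := fun m _ =>
    integrable_of_abs_le m hℓmeas fun u => (abs_of_nonneg (hℓ0 u)).trans_le (hℓ u).2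
  have hlow : ∀ (m : Measure E) [IsProbabilityMeasure m], κ ≤ ∫ u, ℓ u ∂m := fun m _ => by
    simpa using integral_mono (integrable_const κ) (hint m) fun u => (hℓ u).1
  have hnum : ∀ (m : Measure E) [IsProbabilityMeasure m],
      |∫ u, ℓ u * ∫ z, f z ∂(K u) ∂m| ≤ ∫ u, ℓ u ∂m := fun m _ => by
    rw [← Real.norm_eq_abs]
    refine norm_integral_le_of_norm_le (hint m) (ae_of_all _ fun u => ?_)
    rw [Real.norm_eq_abs, abs_mul, abs_of_nonneg (hℓ0 u)]
    exact mul_le_of_le_one_right (hℓ0 u) (hKf u)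
  have hgi := integrable_sq_integral_sub_integral P hμ hν hgm hg1
  have hhi := integrable_sq_integral_sub_integral P hμ hν hhm hκℓ
  refine Real.sqrt_le_iff.2 ⟨by positivity, ?_⟩
  refine (integral_mono_of_nonneg (ae_of_all _ fun ω => by positivity)
    ((hgi.add hhi).const_mul (2 / κ ^ 4)) (ae_of_all _ fun ω => ?_)).trans ?_
  · have := hμ.1 ω
    have := hν.1 ω
    simp only [Pi.add_apply, integral_const_mul]
    rw [integral_phiMap hℓmeas hℓ0 (fun u => (hℓ u).2) K (μ ω) hf hf1,
      integral_phiMap hℓmeas hℓ0 (fun u => (hℓ u).2) K (ν ω) hf hf1]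
    exact sq_inv_mul_sub_inv_mul_le hκ (hlow _) (hlow _) (hnum _)
  · rw [integral_const_mul, integral_add' hgi hhi]
    calc _ ≤ 2 / κ ^ 4 * (dRPM P μ ν ^ 2 + dRPM P μ ν ^ 2) := by
          gcongr
          · exact integral_sq_le_dRPM_sq P hμ hν hgm hg1
          · exact integral_sq_le_dRPM_sq P hμ hν hhm hκℓ
      _ = _ := by ring
end

section
/- Let (E, ℰ) be a measurable space, (Ω', F', P') a probability space, μ : Ω' → (probability measures on E) a random probability measure, and M ≥ 1. On the product space Ω = Ω' × E^M equip with the measure P given by first drawing ω' ∼ P' and then drawing v^{(1)}, …, v^{(M)} i.i.d. from μ(ω') (i.e., P is the semidirect product of P' with the M-fold product kernel ω' ↦ μ(ω')^{⊗M}). Then for every bounded measurable f : E → ℝ with sup_{v∈E}|f(v)| ≤ 1, ∫_Ω | μ(ω')(f) − (1/M) Σ_{k=1}^M f(v^{(k)}) |² dP ≤ 1/M; that is, the conditional sampling error bound d(S^M μ, μ) ≤ 1/√M holds also when the sampled measure μ is itself random and the M samples are conditionally i.i.d. given μ. -/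
open MeasureTheory ProbabilityTheory

/-- A random probability measure is measurable for the canonical σ-algebra on measures. -/
lemma IsRandomProbabilityMeasure.measurable {Ω E : Type*} [MeasurableSpace Ω] [MeasurableSpace E]
    {μ : Ω → Measure E} (hμ : IsRandomProbabilityMeasure μ) : Measurable μ := by
  refine Measure.measurable_of_measurable_coe _ fun s hs => ?_
  have := hμ.1
  have h := hμ.2 (s.indicator fun _ => 1) (measurable_const.indicator hs) fun v => by
    by_cases hv : v ∈ s <;> simp [hv]
  have h' : (fun ω => μ ω s) =
      fun ω => ENNReal.ofReal (∫ x, s.indicator (fun _ => (1 : ℝ)) x ∂(μ ω)) := by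
    ext ω
    rw [integral_indicator_const _ hs]
    simp
  rw [h']
  exact h.ennreal_ofReal

lemma measurable_pi_of_measurable {Ω E ι : Type*} [Fintype ι] [MeasurableSpace Ω]
    [MeasurableSpace E] {μ : Ω → Measure E} [∀ ω, IsProbabilityMeasure (μ ω)]
    (hμ : Measurable μ) : Measurable fun ω => Measure.pi fun _ : ι => μ ω := by
  refine Measurable.measure_of_isPiSystem_of_isProbabilityMeasure generateFrom_pi.symm
    isPiSystem_pi ?_
  rintro _ ⟨B, hB, rfl⟩
  simp only [Measure.pi_pi]
  exact Finset.measurable_prod _ fun k _ =>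
    (Measure.measurable_coe (hB k (Set.mem_univ k))).comp hμ

/-- Finite measures on `α × (ι → β)` that agree on measurable rectangles are equal. -/
lemma MeasureTheory.Measure.ext_prod_pi {α β ι : Type*} [Fintype ι] [MeasurableSpace α]
    [MeasurableSpace β] {P Q : Measure (α × (ι → β))} [IsFiniteMeasure P]
    (h : ∀ A : Set α, MeasurableSet A → ∀ B : ι → Set β, (∀ k, MeasurableSet (B k)) →
      P (A ×ˢ Set.univ.pi B) = Q (A ×ˢ Set.univ.pi B)) : P = Q := by
  refine Measure.ext_prod fun {A t} hA ht => ?_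
  have key : (P.restrict (A ×ˢ Set.univ)).map Prod.snd =
      (Q.restrict (A ×ˢ Set.univ)).map Prod.snd := by
    have hs : ∀ (R : Measure (α × (ι → β))) {t : Set (ι → β)}, MeasurableSet t →
        (R.restrict (A ×ˢ Set.univ)).map Prod.snd t = R (A ×ˢ t) := fun R t ht => by
      rw [Measure.map_apply measurable_snd ht, Measure.restrict_apply (measurable_snd ht)]
      congr 1
      ext x
      simp [and_comm]
    refine ext_of_generate_finite _ generateFrom_pi.symm isPiSystem_pi ?_ ?_
    · rintro _ ⟨B, hB, rfl⟩
      have hB' : ∀ k, MeasurableSet (B k) := fun k => hB k (Set.mem_univ k)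
      rw [hs P (MeasurableSet.univ_pi hB'), hs Q (MeasurableSet.univ_pi hB'), h A hA B hB']
    · rw [hs P .univ, hs Q .univ]
      simpa using h A hA (fun _ => Set.univ) fun _ => .univ
  have := congrArg (fun R => R t) key
  simp only [Measure.map_apply measurable_snd ht,
    Measure.restrict_apply (measurable_snd ht)] at this
  convert this using 2 <;> (ext x; simp [and_comm])

/-- Mean square error of the empirical mean of `M` i.i.d. samples of a function bounded by `1`. -/
lemma integral_sq_integral_sub_empirical_mean_le {E : Type*} [MeasurableSpace E] (μ : Measure E)
    [IsProbabilityMeasure μ] {M : ℕ} (hM : 1 ≤ M) {f : E → ℝ} (hf : Measurable f)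
    (hf1 : ∀ x, |f x| ≤ 1) :
    ∫ v, |(∫ x, f x ∂μ) - (M : ℝ)⁻¹ * ∑ k : Fin M, f (v k)| ^ 2 ∂(Measure.pi fun _ => μ)
      ≤ 1 / M := by
  have hM0 : (M : ℝ) ≠ 0 := by positivity
  have hIcc : ∀ᵐ x ∂μ, f x ∈ Set.Icc (-1 : ℝ) 1 := ae_of_all _ fun x => abs_le.mp (hf1 x)
  have hLp : MemLp f 2 μ := memLp_of_bounded hIcc hf.aestronglyMeasurable 2
  have hmean : ∫ v, (M : ℝ)⁻¹ * ∑ k : Fin M, f (v k) ∂(Measure.pi fun _ => μ) = ∫ x, f x ∂μ := by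
    rw [integral_const_mul, integral_finsetSum]
    · simp only [integral_comp_eval (μ := fun _ : Fin M => μ) hf.aestronglyMeasurable]
      simp [hM0]
    · intro k _
      exact (measurePreserving_eval (fun _ : Fin M => μ) k).integrable_comp_of_integrable
        (hLp.integrable (by norm_num))
  have hvar : Var[fun v => (M : ℝ)⁻¹ * ∑ k : Fin M, f (v k); Measure.pi fun _ => μ]
      = (M : ℝ)⁻¹ * Var[f; μ] := by
    have h := variance_sum_pi (μ := fun _ : Fin M => μ) (X := fun _ => f) fun _ => hLp
    have h' : (∑ k : Fin M, fun v : Fin M → E => f (v k)) = fun v => ∑ k : Fin M, f (v k) := by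
      ext v
      simp
    rw [h'] at h
    rw [variance_const_mul, h]
    simp
    field_simp
  have hle : Var[f; μ] ≤ 1 := by
    simpa using (variance_le_sq_of_bounded hIcc hf.aemeasurable).trans (by norm_num)
  rw [variance_eq_integral (Measurable.aemeasurable (by fun_prop)), hmean] at hvar
  simp only [sq_abs]
  calc _ = (M : ℝ)⁻¹ * Var[f; μ] := by
        rw [← hvar]
        congr 1 with v
        ring
    _ ≤ (M : ℝ)⁻¹ * 1 := by gcongr
    _ = 1 / M := by simp

theorem conditional_empirical_measure_error
    {Ω' E : Type*} [MeasurableSpace Ω'] [MeasurableSpace E]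
    (P' : Measure Ω') [IsProbabilityMeasure P']
    (μ : Ω' → Measure E) (hμ : IsRandomProbabilityMeasure μ)
    (M : ℕ) (hM : 1 ≤ M)
    (P : Measure (Ω' × (Fin M → E))) [IsProbabilityMeasure P]
    -- `P` is the semidirect product of `P'` with the `M`-fold product kernel
    -- `ω' ↦ μ(ω')^{⊗M}`, characterized on measurable rectangles:
    (hP : ∀ A : Set Ω', MeasurableSet A → ∀ B : Fin M → Set E,
      (∀ k, MeasurableSet (B k)) →
      P (A ×ˢ Set.univ.pi B) = ∫⁻ ω' in A, ∏ k : Fin M, μ ω' (B k) ∂P') :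
    (∀ f : E → ℝ, Measurable f → (∀ x, |f x| ≤ 1) →
        (∫ ω, |(∫ x, f x ∂(μ ω.1)) - (M : ℝ)⁻¹ * ∑ k : Fin M, f (ω.2 k)| ^ 2 ∂P)
          ≤ 1 / M) ∧
      dRPM P (fun ω => (M : ENNReal)⁻¹ • ∑ k : Fin M, Measure.dirac (ω.2 k))
          (fun ω => μ ω.1) ≤ 1 / Real.sqrt M := by
  have hprob := hμ.1
  let κ : Kernel Ω' (Fin M → E) :=
    ⟨fun ω => Measure.pi fun _ => μ ω, measurable_pi_of_measurable hμ.measurable⟩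
  have hκ : ∀ ω, κ ω = Measure.pi fun _ => μ ω := fun _ => rfl
  have : IsMarkovKernel κ := ⟨fun ω => by rw [hκ]; infer_instance⟩
  have hPκ : P = P' ⊗ₘ κ := by
    refine Measure.ext_prod_pi fun A hA B hB => ?_
    rw [hP A hA B hB, Measure.compProd_apply_prod hA (.univ_pi hB)]
    simp [hκ, Measure.pi_pi]
  have bound : ∀ f : E → ℝ, Measurable f → (∀ x, |f x| ≤ 1) →
      (∫ ω, |(∫ x, f x ∂(μ ω.1)) - (M : ℝ)⁻¹ * ∑ k : Fin M, f (ω.2 k)| ^ 2 ∂P) ≤ 1 / M := by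
    intro f hf hf1
    have hmeas : Measurable fun ω : Ω' × (Fin M → E) =>
        |(∫ x, f x ∂(μ ω.1)) - (M : ℝ)⁻¹ * ∑ k : Fin M, f (ω.2 k)| ^ 2 := by
      have h1 : Measurable fun ω : Ω' × (Fin M → E) => ∫ x, f x ∂(μ ω.1) :=
        (hμ.2 f hf hf1).comp measurable_fst
      have h2 : Measurable fun ω : Ω' × (Fin M → E) => (M : ℝ)⁻¹ * ∑ k : Fin M, f (ω.2 k) := by
        fun_prop
      exact (measurable_norm.comp (h1.sub h2)).pow_const 2
    have hint : Integrable (fun ω : Ω' × (Fin M → E) =>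
        |(∫ x, f x ∂(μ ω.1)) - (M : ℝ)⁻¹ * ∑ k : Fin M, f (ω.2 k)| ^ 2) (P' ⊗ₘ κ) := by
      refine Integrable.of_bound hmeas.aestronglyMeasurable (2 ^ 2) (ae_of_all _ fun ω => ?_)
      have h1 : |∫ x, f x ∂(μ ω.1)| ≤ 1 := by
        simpa using norm_integral_le_of_norm_le_const (μ := μ ω.1) (f := f) (C := 1) (ae_of_all _ hf1)
      have h2 : |(M : ℝ)⁻¹ * ∑ k : Fin M, f (ω.2 k)| ≤ 1 := by
        rw [abs_mul, abs_of_nonneg (by positivity)]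
        calc _ ≤ (M : ℝ)⁻¹ * ∑ k : Fin M, (1 : ℝ) := by
              gcongr
              exact (Finset.abs_sum_le_sum_abs _ _).trans (Finset.sum_le_sum fun k _ => hf1 _)
          _ = 1 := by
              have : (M : ℝ) ≠ 0 := by positivity
              simp [this]
      rw [Real.norm_of_nonneg (by positivity)]
      gcongr
      exact (abs_sub _ _).trans (by linarith)
    rw [hPκ, Measure.integral_compProd hint]
    calc _ ≤ ∫ _, (1 / M : ℝ) ∂P' := by
          refine integral_mono_of_nonneg (ae_of_all _ fun ω => ?_) (integrable_const _)
            (ae_of_all _ fun ω => ?_)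
          · exact integral_nonneg fun v => by positivity
          · exact integral_sq_integral_sub_empirical_mean_le (μ ω) hM hf hf1
      _ = 1 / M := by simp
  refine ⟨bound, Real.sSup_le ?_ (by positivity)⟩
  rintro r ⟨f, hf, hf1, rfl⟩
  have hemp : ∀ v : Fin M → E,
      ∫ x, f x ∂((M : ENNReal)⁻¹ • ∑ k : Fin M, Measure.dirac (v k))
        = (M : ℝ)⁻¹ * ∑ k : Fin M, f (v k) := by
    intro v
    rw [integral_smul_measure, integral_finsetSum_measure]
    · simp [integral_dirac' _ _ hf.stronglyMeasurable]
    · exact fun k _ => Integrable.of_bound hf.aestronglyMeasurable 1 (ae_of_all _ hf1)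
  rw [← Real.sqrt_one, ← Real.sqrt_div zero_le_one]
  refine Real.sqrt_le_sqrt ?_
  simp only [hemp]
  simpa only [abs_sub_comm] using bound f hf hf1
end

section
/- Let (E, ℰ) be a measurable space, κ > 0, ℓ : E → ℝ measurable with κ ≤ ℓ(u) ≤ 1/κ for all u ∈ E, K a Markov kernel on E, and Φ the map on probability measures defined by (Φμ)(A) = (∫ ℓ(y) K(y, A) μ(dy)) / μ(ℓ). Let ν and ν^M be random probability measures on E on a common probability space, and suppose S^M(Φν^M) is a random probability measure satisfying d(S^M(Φν^M), Φν^M) ≤ 1/√M. Then the one-step error bound d(Φν, S^M(Φν^M)) ≤ (2/κ²) · d(ν, ν^M) + 1/√M holds. -/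
open MeasureTheory ProbabilityTheory

lemma sqrt_integral_abs_sq_eq_lpNorm {Ω : Type*} [MeasurableSpace Ω] {P : Measure Ω}
    {Z : Ω → ℝ} (hZ : AEStronglyMeasurable Z P) :
    Real.sqrt (∫ ω, |Z ω| ^ 2 ∂P) = lpNorm Z 2 P := by
  rw [lpNorm_eq_integral_norm_rpow_toReal (by simp) (by simp) hZ, Real.sqrt_eq_rpow]
  simp

lemma abs_integral_le_of_forall_abs_le {E : Type*} [MeasurableSpace E] (μ : Measure E)
    [IsProbabilityMeasure μ] {f : E → ℝ} {C : ℝ} (hf : ∀ v, |f v| ≤ C) :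
    |∫ x, f x ∂μ| ≤ C := by
  simpa using norm_integral_le_of_norm_le_const (μ := μ) (f := f) (.of_forall hf)

lemma abs_div_sub_div_le {κ a m a' m' : ℝ} (hκ : 0 < κ) (hm : κ ≤ m) (hm' : 0 < m')
    (ha' : |a' / m'| ≤ 1) :
    |a / m - a' / m'| ≤ κ⁻¹ * (|a - a'| + |m - m'|) := by
  have hm0 : 0 < m := hκ.trans_le hm
  have key : a / m - a' / m' = m⁻¹ * ((a - a') - a' / m' * (m - m')) := by
    field_simp
    ring
  have hle : |(a - a') - a' / m' * (m - m')| ≤ |a - a'| + |m - m'| := by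
    refine (abs_sub _ _).trans ?_
    rw [abs_mul]
    gcongr
    exact mul_le_of_le_one_left (abs_nonneg _) ha'
  rw [key, abs_mul, abs_of_pos (inv_pos.2 hm0)]
  gcongr

section RandomMeasure

variable {Ω E : Type*} [MeasurableSpace Ω] [MeasurableSpace E] {P : Measure Ω}
  {μ ν : Ω → Measure E}

lemma IsRandomProbabilityMeasure.measurable_integral (hμ : IsRandomProbabilityMeasure μ)
    {g : E → ℝ} {C : ℝ} (hC : 0 < C) (hg : Measurable g) (hgC : ∀ v, |g v| ≤ C) :
    Measurable fun ω => ∫ x, g x ∂(μ ω) := by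
  have h := hμ.2 (fun x => C⁻¹ * g x) (hg.const_mul _) fun v => by
    rw [abs_mul, abs_of_pos (inv_pos.2 hC), inv_mul_le_one₀ hC]
    exact hgC v
  simp_rw [integral_const_mul] at h
  convert h.const_mul C using 2
  field_simp

lemma IsRandomProbabilityMeasure.memLp_integral_sub [IsFiniteMeasure P]
    (hμ : IsRandomProbabilityMeasure μ) (hν : IsRandomProbabilityMeasure ν)
    {g : E → ℝ} {C : ℝ} (hC : 0 < C) (hg : Measurable g) (hgC : ∀ v, |g v| ≤ C) :
    MemLp (fun ω => (∫ x, g x ∂(μ ω)) - ∫ x, g x ∂(ν ω)) 2 P := by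
  refine .of_bound ((hμ.measurable_integral hC hg hgC).sub
    (hν.measurable_integral hC hg hgC)).aestronglyMeasurable (C + C) (.of_forall fun ω => ?_)
  have := hμ.1 ω
  have := hν.1 ω
  exact (abs_sub _ _).trans (add_le_add (abs_integral_le_of_forall_abs_le _ hgC)
    (abs_integral_le_of_forall_abs_le _ hgC))

lemma dRPM_comm (P : Measure Ω) (μ ν : Ω → Measure E) : dRPM P μ ν = dRPM P ν μ := by
  simp_rw [dRPM, abs_sub_comm]

lemma lpNorm_integral_sub_le_dRPM [IsProbabilityMeasure P]
    (hμ : IsRandomProbabilityMeasure μ) (hν : IsRandomProbabilityMeasure ν)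
    {f : E → ℝ} (hf : Measurable f) (hf1 : ∀ v, |f v| ≤ 1) :
    lpNorm (fun ω => (∫ x, f x ∂(μ ω)) - ∫ x, f x ∂(ν ω)) 2 P ≤ dRPM P μ ν := by
  refine le_csSup ⟨2, ?_⟩ ⟨f, hf, hf1, (sqrt_integral_abs_sq_eq_lpNorm
    (hμ.memLp_integral_sub hν one_pos hf hf1).aestronglyMeasurable).symm⟩
  rintro r ⟨g, hg, hg1, rfl⟩
  rw [sqrt_integral_abs_sq_eq_lpNorm
    (hμ.memLp_integral_sub hν one_pos hg hg1).aestronglyMeasurable]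
  refine (lpNorm_mono_real (g := fun _ => (2 : ℝ)) (memLp_const _) fun ω => ?_).trans ?_
  · have := hμ.1 ω
    have := hν.1 ω
    refine (abs_sub _ _).trans ((add_le_add (abs_integral_le_of_forall_abs_le _ hg1)
      (abs_integral_le_of_forall_abs_le _ hg1)).trans_eq one_add_one_eq_two)
  · simp

lemma lpNorm_integral_sub_le_mul_dRPM [IsProbabilityMeasure P]
    (hμ : IsRandomProbabilityMeasure μ) (hν : IsRandomProbabilityMeasure ν)
    {g : E → ℝ} {C : ℝ} (hC : 0 < C) (hg : Measurable g) (hgC : ∀ v, |g v| ≤ C) :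
    lpNorm (fun ω => (∫ x, g x ∂(μ ω)) - ∫ x, g x ∂(ν ω)) 2 P ≤ C * dRPM P μ ν := by
  have h := lpNorm_integral_sub_le_dRPM (P := P) hμ hν (f := fun x => C⁻¹ * g x)
    (hg.const_mul _) fun v => by
      rw [abs_mul, abs_of_pos (inv_pos.2 hC), inv_mul_le_one₀ hC]
      exact hgC v
  simp_rw [integral_const_mul, ← mul_sub] at h
  have h' := lpNorm_const_smul (p := 2) C⁻¹
    (fun ω => (∫ x, g x ∂(μ ω)) - ∫ x, g x ∂(ν ω)) P
  rw [coe_nnnorm, Real.norm_of_nonneg (inv_pos.2 hC).le] at h'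
  rw [← inv_mul_le_iff₀ hC]
  exact h'.symm.trans_le h

end RandomMeasure

section PhiMap

variable {Ω E : Type*} [MeasurableSpace Ω] [MeasurableSpace E] {κ : ℝ} {ℓ : E → ℝ}
  {K : Kernel E E}

lemma isProbabilityMeasure_PhiMap [IsMarkovKernel K] {μ : Measure E} (hℓ : Integrable ℓ μ)
    (hℓ0 : ∀ u, 0 ≤ ℓ u) (hpos : 0 < ∫ y, ℓ y ∂μ) :
    IsProbabilityMeasure (PhiMap ℓ K μ) := by
  constructor
  rw [PhiMap, Measure.smul_apply, Measure.bind_apply .univ K.measurable.aemeasurable]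
  simp only [measure_univ, lintegral_const, one_mul, withDensity_apply _ MeasurableSet.univ,
    Measure.restrict_univ, smul_eq_mul]
  rw [← ofReal_integral_eq_lintegral_ofReal hℓ (.of_forall hℓ0)]
  exact ENNReal.inv_mul_cancel (by simpa using hpos) (by simp)

lemma integral_PhiMap [IsMarkovKernel K] {μ : Measure E} (hℓmeas : Measurable ℓ)
    (hℓ : Integrable ℓ μ) (hℓ0 : ∀ u, 0 ≤ ℓ u)
    {f : E → ℝ} (hf : Measurable f) {C : ℝ} (hfC : ∀ v, |f v| ≤ C) :
    ∫ x, f x ∂(PhiMap ℓ K μ) = (∫ y, ℓ y * ∫ x, f x ∂(K y) ∂μ) / ∫ y, ℓ y ∂μ := by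
  have hfin : IsFiniteMeasure (μ.withDensity fun y => ENNReal.ofReal (ℓ y)) :=
    isFiniteMeasure_withDensity_ofReal hℓ.2
  have hbind : ∫ x, f x ∂((μ.withDensity fun y => ENNReal.ofReal (ℓ y)).bind fun y => K y)
      = ∫ y, ∫ x, f x ∂(K y) ∂(μ.withDensity fun y => ENNReal.ofReal (ℓ y)) := by
    have hint : Integrable f
        ((K ∘ₖ Kernel.const Unit (μ.withDensity fun y => ENNReal.ofReal (ℓ y))) ()) :=
      .of_bound hf.aestronglyMeasurable C (.of_forall hfC)
    change ∫ x, f x ∂(Measure.bind _ ⇑K) = _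
    rw [Measure.comp_eq_comp_const_apply, Kernel.integral_comp hint, Kernel.const_apply]
  rw [PhiMap, integral_smul_measure, hbind, integral_withDensity_eq_integral_toReal_smul
    (by fun_prop) (by simp)]
  simp_rw [ENNReal.toReal_inv, ENNReal.toReal_ofReal (hℓ0 _),
    ENNReal.toReal_ofReal (integral_nonneg hℓ0), smul_eq_mul]
  rw [div_eq_inv_mul]

lemma integrable_of_pinched (hκ : 0 < κ) (hℓmeas : Measurable ℓ)
    (hℓ : ∀ u, κ ≤ ℓ u ∧ ℓ u ≤ 1 / κ) (μ : Measure E) [IsFiniteMeasure μ] :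
    Integrable ℓ μ :=
  .of_bound hℓmeas.aestronglyMeasurable (1 / κ) (.of_forall fun u => by
    rw [Real.norm_of_nonneg (hκ.le.trans (hℓ u).1)]
    exact (hℓ u).2)

lemma le_integral_of_pinched (hκ : 0 < κ) (hℓmeas : Measurable ℓ)
    (hℓ : ∀ u, κ ≤ ℓ u ∧ ℓ u ≤ 1 / κ) (μ : Measure E) [IsProbabilityMeasure μ] :
    κ ≤ ∫ y, ℓ y ∂μ := by
  simpa using integral_mono (integrable_const κ) (integrable_of_pinched hκ hℓmeas hℓ μ)
    fun u => (hℓ u).1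

lemma measurable_mul_integral_kernel [IsMarkovKernel K] (hℓmeas : Measurable ℓ)
    {f : E → ℝ} (hf : Measurable f) : Measurable fun y => ℓ y * ∫ x, f x ∂(K y) :=
  hℓmeas.mul hf.stronglyMeasurable.integral_kernel.measurable

lemma abs_mul_integral_kernel_le [IsMarkovKernel K] (hκ : 0 < κ)
    (hℓ : ∀ u, κ ≤ ℓ u ∧ ℓ u ≤ 1 / κ) {f : E → ℝ} (hf1 : ∀ v, |f v| ≤ 1) (y : E) :
    |ℓ y * ∫ x, f x ∂(K y)| ≤ 1 / κ := by
  have h0 : 0 ≤ ℓ y := hκ.le.trans (hℓ y).1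
  rw [abs_mul, abs_of_nonneg h0]
  exact (mul_le_of_le_one_right h0 (abs_integral_le_of_forall_abs_le _ hf1)).trans (hℓ y).2

lemma IsRandomProbabilityMeasure.phiMap [IsMarkovKernel K] (hκ : 0 < κ)
    (hℓmeas : Measurable ℓ) (hℓ : ∀ u, κ ≤ ℓ u ∧ ℓ u ≤ 1 / κ) {μ : Ω → Measure E}
    (hμ : IsRandomProbabilityMeasure μ) :
    IsRandomProbabilityMeasure fun ω => PhiMap ℓ K (μ ω) := by
  have hℓ0 : ∀ u, 0 ≤ ℓ u := fun u => hκ.le.trans (hℓ u).1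
  have hint : ∀ ω, Integrable ℓ (μ ω) := fun ω =>
    have := hμ.1 ω
    integrable_of_pinched hκ hℓmeas hℓ _
  refine ⟨fun ω => ?_, fun f hf hf1 => ?_⟩
  · have := hμ.1 ω
    exact isProbabilityMeasure_PhiMap (hint ω) hℓ0
      (hκ.trans_le (le_integral_of_pinched hκ hℓmeas hℓ _))
  · simp_rw [integral_PhiMap hℓmeas (hint _) hℓ0 hf hf1]
    exact (hμ.measurable_integral (one_div_pos.2 hκ) (measurable_mul_integral_kernel hℓmeas hf)
        (abs_mul_integral_kernel_le hκ hℓ hf1)).div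
      (hμ.measurable_integral (one_div_pos.2 hκ) hℓmeas
        fun u => by rw [abs_of_nonneg (hℓ0 u)]; exact (hℓ u).2)

/-- The map `Φ` is Lipschitz for `dRPM`, tested against a single function. -/
lemma lpNorm_integral_PhiMap_sub_le [IsMarkovKernel K] (P : Measure Ω) [IsProbabilityMeasure P]
    (hκ : 0 < κ) (hℓmeas : Measurable ℓ) (hℓ : ∀ u, κ ≤ ℓ u ∧ ℓ u ≤ 1 / κ)
    {μ ν : Ω → Measure E} (hμ : IsRandomProbabilityMeasure μ)
    (hν : IsRandomProbabilityMeasure ν)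
    {f : E → ℝ} (hf : Measurable f) (hf1 : ∀ v, |f v| ≤ 1) :
    lpNorm (fun ω => (∫ x, f x ∂(PhiMap ℓ K (μ ω))) - ∫ x, f x ∂(PhiMap ℓ K (ν ω))) 2 P ≤
      2 / κ ^ 2 * dRPM P μ ν := by
  have hℓ0 : ∀ u, 0 ≤ ℓ u := fun u => hκ.le.trans (hℓ u).1
  have hℓabs : ∀ u, |ℓ u| ≤ 1 / κ := fun u => by
    rw [abs_of_nonneg (hℓ0 u)]
    exact (hℓ u).2
  have hC : 0 < 1 / κ := one_div_pos.2 hκ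
  have hgmeas := measurable_mul_integral_kernel (K := K) hℓmeas hf
  have hgabs := abs_mul_integral_kernel_le (K := K) hκ hℓ hf1
  have hA := hμ.memLp_integral_sub (P := P) hν hC hgmeas hgabs
  have hB := hμ.memLp_integral_sub (P := P) hν hC hℓmeas hℓabs
  have hAle := lpNorm_integral_sub_le_mul_dRPM (P := P) hμ hν hC hgmeas hgabs
  have hBle := lpNorm_integral_sub_le_mul_dRPM (P := P) hμ hν hC hℓmeas hℓabs
  set A := fun ω => (∫ y, ℓ y * ∫ x, f x ∂(K y) ∂(μ ω)) - ∫ y, ℓ y * ∫ x, f x ∂(K y) ∂(ν ω)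
  set B := fun ω => (∫ y, ℓ y ∂(μ ω)) - ∫ y, ℓ y ∂(ν ω)
  have hpt : ∀ ω, ‖(∫ x, f x ∂(PhiMap ℓ K (μ ω))) - ∫ x, f x ∂(PhiMap ℓ K (ν ω))‖ ≤
      (κ⁻¹ • (|A| + |B|)) ω := fun ω => by
    have := hμ.1 ω
    have := hν.1 ω
    have := (hν.phiMap (K := K) hκ hℓmeas hℓ).1 ω
    have hν1 := abs_integral_le_of_forall_abs_le (PhiMap ℓ K (ν ω)) hf1
    have hintμ := integrable_of_pinched hκ hℓmeas hℓ (μ ω)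
    have hintν := integrable_of_pinched hκ hℓmeas hℓ (ν ω)
    rw [integral_PhiMap hℓmeas hintν hℓ0 hf hf1] at hν1 ⊢
    rw [integral_PhiMap hℓmeas hintμ hℓ0 hf hf1]
    exact abs_div_sub_div_le hκ (le_integral_of_pinched hκ hℓmeas hℓ _)
      (hκ.trans_le (le_integral_of_pinched hκ hℓmeas hℓ _)) hν1
  calc _ ≤ lpNorm (κ⁻¹ • (|A| + |B|)) 2 P :=
        lpNorm_mono_real ((hA.abs.add hB.abs).const_smul κ⁻¹) hpt
    _ = κ⁻¹ * lpNorm (|A| + |B|) 2 P := by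
        rw [lpNorm_const_smul, coe_nnnorm, Real.norm_of_nonneg (inv_pos.2 hκ).le]
    _ ≤ κ⁻¹ * (lpNorm A 2 P + lpNorm B 2 P) := by
        gcongr
        rw [← lpNorm_abs hA.aestronglyMeasurable, ← lpNorm_abs hB.aestronglyMeasurable]
        exact lpNorm_add_le hA.abs one_le_two
    _ ≤ κ⁻¹ * (1 / κ * dRPM P μ ν + 1 / κ * dRPM P μ ν) := by gcongr
    _ = 2 / κ ^ 2 * dRPM P μ ν := by
        field_simp
        ring

end PhiMap

theorem one_step_error_bound
    {Ω E : Type*} [MeasurableSpace Ω] [MeasurableSpace E]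
    (P : Measure Ω) [IsProbabilityMeasure P]
    (κ : ℝ) (hκ : 0 < κ)
    (ℓ : E → ℝ) (hℓmeas : Measurable ℓ)
    (hℓ : ∀ u, κ ≤ ℓ u ∧ ℓ u ≤ 1 / κ)
    (K : Kernel E E) [IsMarkovKernel K]
    (M : ℕ) (hM : 1 ≤ M)
    (ν νM : Ω → Measure E)
    (hν : IsRandomProbabilityMeasure ν) (hνM : IsRandomProbabilityMeasure νM)
    (SM : Ω → Measure E) (hSM : IsRandomProbabilityMeasure SM)
    (hSMerr : dRPM P SM (fun ω => PhiMap ℓ K (νM ω)) ≤ 1 / Real.sqrt M) :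
    dRPM P (fun ω => PhiMap ℓ K (ν ω)) SM ≤
      2 / κ ^ 2 * dRPM P ν νM + 1 / Real.sqrt M := by
  have hΦν := hν.phiMap (K := K) hκ hℓmeas hℓ
  have hΦνM := hνM.phiMap (K := K) hκ hℓmeas hℓ
  refine csSup_le ⟨_, 0, measurable_zero, by simp, rfl⟩ ?_
  rintro r ⟨f, hf, hf1, rfl⟩
  rw [sqrt_integral_abs_sq_eq_lpNorm
    (hΦν.memLp_integral_sub hSM one_pos hf hf1).aestronglyMeasurable]
  have h₁ := lpNorm_integral_PhiMap_sub_le (K := K) P hκ hℓmeas hℓ hν hνM hf hf1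
  have h₂ := lpNorm_integral_sub_le_dRPM (P := P) hΦνM hSM hf hf1
  rw [dRPM_comm] at h₂
  have h₃ := lpNorm_add_le (g := fun ω => (∫ x, f x ∂(PhiMap ℓ K (νM ω))) - ∫ x, f x ∂(SM ω))
    (hΦν.memLp_integral_sub (P := P) hΦνM one_pos hf hf1) one_le_two
  simp only [Pi.add_def, sub_add_sub_cancel] at h₃
  exact h₃.trans (add_le_add h₁ (h₂.trans hSMerr))
end
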